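/- arXiv:1904.07049 — 2 statements merged into one kernel-verified Lean document; each statement's English description precedes it below -/
import Mathlib

section
/- Let x ∈ V solve the constrained reduced optimality system b_K(x,φ) = −α^{−1/2}⟨u_d, Iφ₁⟩_W for all φ ∈ V, and let x_h ∈ V_h solve b_K(x_h,φ_h) = −α^{−1/2}⟨u_d, Iφ_{h,1}⟩_W for all φ_h ∈ V_h. Then d_{K,α}(x, x_h) ≤ (κ_h·μ_h + 1)·inf_{v_h ∈ V_h} d_{K,α}(x, v_h), where κ_h = ((1+2L)/(1+L))·(1 + M(1 + 2M/√α)·μ_h) with L = M/√α. -/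
open scoped RealInnerProductSpace
open Filter Topology

noncomputable section Setup

variable {V₁ V₂ Q W : Type*}
  [NormedAddCommGroup V₁] [InnerProductSpace ℝ V₁]
  [NormedAddCommGroup V₂] [InnerProductSpace ℝ V₂]
  [NormedAddCommGroup Q] [InnerProductSpace ℝ Q]
  [NormedAddCommGroup W] [InnerProductSpace ℝ W]

/-- The ℓ²-norm on the product space `V = V₁ × V₂`. -/
def nV (v : V₁ × V₂) : ℝ := Real.sqrt (‖v.1‖ ^ 2 + ‖v.2‖ ^ 2)

/-- The seminorm `|v| = (‖I v₁‖² + ‖C* v₂‖²)^{1/2}`. -/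
def sV (Cs : V₂ →L[ℝ] Q) (Iop : V₁ →L[ℝ] W) (v : V₁ × V₂) : ℝ :=
  Real.sqrt (‖Iop v.1‖ ^ 2 + ‖Cs v.2‖ ^ 2)

/-- The vectorized bilinear form `a(v,φ) = a(v₁,φ₂) + a(φ₁,v₂)` on `V × V`. -/
def aV (a : V₁ →L[ℝ] V₂ →L[ℝ] ℝ) (v φ : V₁ × V₂) : ℝ := a v.1 φ.2 + a φ.1 v.2

/-- The bilinear form `b = a + α^{-1/2} c` of the rescaled reduced optimality system. -/
def bV (a : V₁ →L[ℝ] V₂ →L[ℝ] ℝ) (Cs : V₂ →L[ℝ] Q) (Iop : V₁ →L[ℝ] W) (α : ℝ)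
    (v φ : V₁ × V₂) : ℝ :=
  aV a v φ + (Real.sqrt α)⁻¹ * (⟪Cs v.2, Cs φ.2⟫ - ⟪Iop v.1, Iop φ.1⟫)

/-- Continuity constant `M_a = sup { a(v₁,v₂) : ‖v₁‖ = 1, ‖v₂‖ = 1 }`. -/
def contConst (a : V₁ →L[ℝ] V₂ →L[ℝ] ℝ) : ℝ :=
  sSup {r : ℝ | ∃ v₁ : V₁, ∃ v₂ : V₂, ‖v₁‖ = 1 ∧ ‖v₂‖ = 1 ∧ r = a v₁ v₂}

/-- Inf-sup constant `m_a = inf_{‖v₂‖=1} sup_{‖v₁‖=1} a(v₁,v₂)`. -/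
def infSupConst (a : V₁ →L[ℝ] V₂ →L[ℝ] ℝ) : ℝ :=
  sInf {r : ℝ | ∃ v₂ : V₂, ‖v₂‖ = 1 ∧
    r = sSup {s : ℝ | ∃ v₁ : V₁, ‖v₁‖ = 1 ∧ s = a v₁ v₂}}

/-- Discrete inf-sup constant of `a` on `V_{h,1} × V_{h,2}`. -/
def discInfSup (a : V₁ →L[ℝ] V₂ →L[ℝ] ℝ) (Vh1 : Submodule ℝ V₁)
    (Vh2 : Submodule ℝ V₂) : ℝ :=
  sInf {r : ℝ | ∃ v₁ ∈ Vh1, ‖v₁‖ = 1 ∧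
    r = sSup {s : ℝ | ∃ φ₂ ∈ Vh2, ‖φ₂‖ = 1 ∧ s = a v₁ φ₂}}

/-- Best approximation error `inf_{v_h ∈ V_h} ‖x - v_h‖` in the product norm. -/
def bestErr (Vh1 : Submodule ℝ V₁) (Vh2 : Submodule ℝ V₂) (x : V₁ × V₂) : ℝ :=
  sInf {r : ℝ | ∃ vh : V₁ × V₂, vh.1 ∈ Vh1 ∧ vh.2 ∈ Vh2 ∧ r = nV (x - vh)}

/-- The quasi-best-approximation constant `ν_h` of the Galerkin discretization of `b`:
`sup` over nonzero discrete test functions of the ratio of the continuous sup to the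
discrete sup. -/
def nuConst (a : V₁ →L[ℝ] V₂ →L[ℝ] ℝ) (Cs : V₂ →L[ℝ] Q) (Iop : V₁ →L[ℝ] W) (α : ℝ)
    (Vh1 : Submodule ℝ V₁) (Vh2 : Submodule ℝ V₂) : ℝ :=
  sSup {r : ℝ | ∃ φh : V₁ × V₂, φh.1 ∈ Vh1 ∧ φh.2 ∈ Vh2 ∧ φh ≠ 0 ∧
    r = sSup {s : ℝ | ∃ v : V₁ × V₂, nV v = 1 ∧ s = bV a Cs Iop α v φh} /
        sSup {s : ℝ | ∃ vh : V₁ × V₂, vh.1 ∈ Vh1 ∧ vh.2 ∈ Vh2 ∧ nV vh = 1 ∧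
          s = bV a Cs Iop α vh φh}}

/-- The nonlinear form `c_{K,α}` associated with the control constraint set `K`
(through its metric projection `PK`). -/
def cK (Cs : V₂ →L[ℝ] Q) (Iop : V₁ →L[ℝ] W) (PK : Q → Q) (α : ℝ) (v φ : V₁ × V₂) : ℝ :=
  -⟪PK ((-(Real.sqrt α)⁻¹) • (Cs v.2)), Cs φ.2⟫ - (Real.sqrt α)⁻¹ * ⟪Iop v.1, Iop φ.1⟫

/-- The nonlinear form `b_K = a + c_{K,α}`. -/
def bK (a : V₁ →L[ℝ] V₂ →L[ℝ] ℝ) (Cs : V₂ →L[ℝ] Q) (Iop : V₁ →L[ℝ] W) (PK : Q → Q)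
    (α : ℝ) (v φ : V₁ × V₂) : ℝ :=
  aV a v φ + cK Cs Iop PK α v φ

/-- The pseudometric `δ_{K,α}`. -/
def deltaK (Cs : V₂ →L[ℝ] Q) (Iop : V₁ →L[ℝ] W) (PK : Q → Q) (α : ℝ)
    (v w : V₁ × V₂) : ℝ :=
  Real.sqrt (α * ‖PK ((-(Real.sqrt α)⁻¹) • (Cs v.2)) -
      PK ((-(Real.sqrt α)⁻¹) • (Cs w.2))‖ ^ 2 + ‖Iop (v.1 - w.1)‖ ^ 2)

end Setup

section PairNorm

variable {E F : Type*} [NormedAddCommGroup E] [NormedAddCommGroup F]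

theorem nV_nonneg (v : E × F) : 0 ≤ nV v := Real.sqrt_nonneg _

theorem nV_sq (v : E × F) : nV v ^ 2 = ‖v.1‖ ^ 2 + ‖v.2‖ ^ 2 :=
  Real.sq_sqrt (by positivity)

theorem nV_eq_norm (v : E × F) : nV v = ‖WithLp.toLp 2 v‖ :=
  (WithLp.prod_norm_eq_of_L2 _).symm

theorem nV_add_le (v w : E × F) : nV (v + w) ≤ nV v + nV w := by
  simpa only [nV_eq_norm, WithLp.toLp_add] using norm_add_le _ _

theorem nV_neg (v : E × F) : nV (-v) = nV v := by
  simp [nV]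

theorem nV_sub_comm (v w : E × F) : nV (v - w) = nV (w - v) := by
  rw [← nV_neg, neg_sub]

theorem mul_add_mul_le_sqrt_mul_sqrt (a b c d : ℝ) :
    a * c + b * d ≤ √(a ^ 2 + b ^ 2) * √(c ^ 2 + d ^ 2) := by
  rw [← Real.sqrt_mul (by positivity)]
  exact Real.le_sqrt_of_sq_le (by nlinarith [sq_nonneg (a * d - b * c)])

end PairNorm

section ProjectedForm

variable {V₁ V₂ Q W : Type*}
  [NormedAddCommGroup V₁] [InnerProductSpace ℝ V₁]
  [NormedAddCommGroup V₂] [InnerProductSpace ℝ V₂]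
  [NormedAddCommGroup Q] [InnerProductSpace ℝ Q]
  [NormedAddCommGroup W] [InnerProductSpace ℝ W]

/-- Metric projections onto convex sets are firmly nonexpansive. -/
theorem norm_sq_le_inner_of_isMinOn_convex {K : Set Q} (hK : Convex ℝ K) {PK : Q → Q}
    (hmem : ∀ q, PK q ∈ K) (hmin : ∀ q, ∀ p ∈ K, ‖q - PK q‖ ≤ ‖q - p‖) (q₁ q₂ : Q) :
    ‖PK q₁ - PK q₂‖ ^ 2 ≤ ⟪PK q₁ - PK q₂, q₁ - q₂⟫ := by
  have key : ∀ q, ∀ p ∈ K, ⟪q - PK q, p - PK q⟫ ≤ 0 := by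
    intro q
    refine (norm_eq_iInf_iff_real_inner_le_zero hK (hmem q)).1 ?_
    have : Nonempty K := ⟨⟨_, hmem q⟩⟩
    refine le_antisymm (le_ciInf fun p => hmin q p p.2) ?_
    exact ciInf_le (f := fun w : K => ‖q - w‖)
      ⟨0, Set.forall_mem_range.2 fun _ => norm_nonneg _⟩ ⟨_, hmem q⟩
  have h₁ := key q₁ _ (hmem q₂)
  have h₂ := key q₂ _ (hmem q₁)
  rw [← real_inner_self_eq_norm_sq]
  simp only [inner_sub_left, inner_sub_right] at *
  have e₁ := real_inner_comm (PK q₁) (PK q₂)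
  have e₂ := real_inner_comm (PK q₁) q₁
  have e₃ := real_inner_comm (PK q₂) q₁
  have e₄ := real_inner_comm (PK q₁) q₂
  have e₅ := real_inner_comm (PK q₂) q₂
  linarith

theorem deltaK_eq_nV (Cs : V₂ →L[ℝ] Q) (Iop : V₁ →L[ℝ] W) (PK : Q → Q) {α : ℝ} (hα : 0 < α)
    (v w : V₁ × V₂) :
    deltaK Cs Iop PK α v w =
      nV (√α • (PK ((-(√α)⁻¹) • Cs v.2) - PK ((-(√α)⁻¹) • Cs w.2)), Iop (v.1 - w.1)) := by
  simp only [deltaK, nV, norm_smul, mul_pow, Real.norm_eq_abs, sq_abs, Real.sq_sqrt hα.le]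

theorem deltaK_nonneg (Cs : V₂ →L[ℝ] Q) (Iop : V₁ →L[ℝ] W) (PK : Q → Q) (α : ℝ)
    (v w : V₁ × V₂) : 0 ≤ deltaK Cs Iop PK α v w := Real.sqrt_nonneg _

theorem deltaK_comm (Cs : V₂ →L[ℝ] Q) (Iop : V₁ →L[ℝ] W) (PK : Q → Q) (α : ℝ)
    (v w : V₁ × V₂) : deltaK Cs Iop PK α v w = deltaK Cs Iop PK α w v := by
  simp only [deltaK, map_sub]
  rw [norm_sub_rev, norm_sub_rev (Iop v.1)]

theorem deltaK_triangle (Cs : V₂ →L[ℝ] Q) (Iop : V₁ →L[ℝ] W) (PK : Q → Q) {α : ℝ} (hα : 0 < α)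
    (u v w : V₁ × V₂) :
    deltaK Cs Iop PK α u w ≤ deltaK Cs Iop PK α u v + deltaK Cs Iop PK α v w := by
  simp only [deltaK_eq_nV Cs Iop PK hα]
  refine le_trans (le_of_eq ?_) (nV_add_le _ _)
  rw [Prod.mk_add_mk, ← smul_add, ← map_add, sub_add_sub_cancel, sub_add_sub_cancel]

theorem abs_cK_sub_le (Cs : V₂ →L[ℝ] Q) (Iop : V₁ →L[ℝ] W) (PK : Q → Q) {α M : ℝ} (hα : 0 < α)
    (hC : ‖Cs‖ ≤ M) (hI : ‖Iop‖ ≤ M) (v w φ : V₁ × V₂) :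
    |cK Cs Iop PK α v φ - cK Cs Iop PK α w φ| ≤
      M / √α * deltaK Cs Iop PK α v w * nV φ := by
  rw [deltaK_eq_nV Cs Iop PK hα]
  have hr : 0 < √α := Real.sqrt_pos.2 hα
  have hM : 0 ≤ M := (norm_nonneg _).trans hC
  set p := PK ((-(√α)⁻¹) • Cs v.2) - PK ((-(√α)⁻¹) • Cs w.2) with hp
  set i := Iop (v.1 - w.1) with hi
  have e : cK Cs Iop PK α v φ - cK Cs Iop PK α w φ =
      -(⟪p, Cs φ.2⟫ + (√α)⁻¹ * ⟪i, Iop φ.1⟫) := by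
    simp only [cK, hp, hi, map_sub, inner_sub_left]; ring
  have h₁ : |⟪p, Cs φ.2⟫| ≤ ‖p‖ * (M * ‖φ.2‖) :=
    (abs_real_inner_le_norm _ _).trans
      (by gcongr; exact Cs.le_of_opNorm_le hC _)
  have h₂ : |⟪i, Iop φ.1⟫| ≤ ‖i‖ * (M * ‖φ.1‖) :=
    (abs_real_inner_le_norm _ _).trans
      (by gcongr; exact Iop.le_of_opNorm_le hI _)
  have h₃ := mul_add_mul_le_sqrt_mul_sqrt (‖i‖) (√α * ‖p‖) (‖φ.1‖) (‖φ.2‖)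
  have h₄ : nV (√α • p, i) = √(‖i‖ ^ 2 + (√α * ‖p‖) ^ 2) := by
    simp only [nV, norm_smul, Real.norm_eq_abs, abs_of_pos hr]; rw [add_comm]
  rw [e, abs_neg]
  calc |⟪p, Cs φ.2⟫ + (√α)⁻¹ * ⟪i, Iop φ.1⟫|
      ≤ |⟪p, Cs φ.2⟫| + (√α)⁻¹ * |⟪i, Iop φ.1⟫| := by
        refine (abs_add_le _ _).trans (le_of_eq ?_)
        rw [abs_mul, abs_of_pos (inv_pos.2 hr)]
    _ ≤ ‖p‖ * (M * ‖φ.2‖) + (√α)⁻¹ * (‖i‖ * (M * ‖φ.1‖)) := by gcongr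
    _ = M / √α * (‖i‖ * ‖φ.1‖ + √α * ‖p‖ * ‖φ.2‖) := by field_simp; ring
    _ ≤ M / √α * (nV (√α • p, i) * nV φ) := by
        rw [h₄]; exact mul_le_mul_of_nonneg_left h₃ (by positivity)
    _ = _ := by ring

theorem deltaK_sq_le (Cs : V₂ →L[ℝ] Q) (Iop : V₁ →L[ℝ] W) {K : Set Q} (hK : Convex ℝ K)
    {PK : Q → Q} (hmem : ∀ q, PK q ∈ K) (hmin : ∀ q, ∀ p ∈ K, ‖q - PK q‖ ≤ ‖q - p‖)
    {α : ℝ} (hα : 0 < α) (v w : V₁ × V₂) :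
    deltaK Cs Iop PK α v w ^ 2 ≤
      √α * (cK Cs Iop PK α v (-(v - w).1, (v - w).2) -
        cK Cs Iop PK α w (-(v - w).1, (v - w).2)) := by
  have hr : 0 < √α := Real.sqrt_pos.2 hα
  have h := norm_sq_le_inner_of_isMinOn_convex hK hmem hmin
    ((-(√α)⁻¹) • Cs v.2) ((-(√α)⁻¹) • Cs w.2)
  rw [← smul_sub, inner_smul_right] at h
  rw [deltaK, Real.sq_sqrt (by positivity)]
  set p := PK ((-(√α)⁻¹) • Cs v.2) - PK ((-(√α)⁻¹) • Cs w.2) with hp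
  have e : √α * (cK Cs Iop PK α v (-(v - w).1, (v - w).2) -
        cK Cs Iop PK α w (-(v - w).1, (v - w).2)) =
      -(√α * ⟪p, Cs v.2 - Cs w.2⟫) + √α * (√α)⁻¹ * ‖Iop (v.1 - w.1)‖ ^ 2 := by
    rw [← real_inner_self_eq_norm_sq]
    simp only [cK, hp, Prod.fst_sub, Prod.snd_sub, map_sub, map_neg, inner_sub_left,
      inner_sub_right, inner_neg_right]
    ring
  have h' := mul_le_mul_of_nonneg_left h hα.le
  have e' : α * (-(√α)⁻¹ * ⟪p, Cs v.2 - Cs w.2⟫) = -(√α * ⟪p, Cs v.2 - Cs w.2⟫) := by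
    nth_rewrite 1 [← Real.mul_self_sqrt hα.le]
    field_simp
  rw [e, mul_inv_cancel₀ hr.ne', one_mul]
  linarith

end ProjectedForm

section InfSup

variable {V₁ V₂ : Type*}
  [NormedAddCommGroup V₁] [InnerProductSpace ℝ V₁]
  [NormedAddCommGroup V₂] [InnerProductSpace ℝ V₂]

theorem abs_le_of_adjointNorm (a : V₁ →L[ℝ] V₂ →L[ℝ] ℝ)
    (hadj : ∀ v₂ : V₂, ‖v₂‖ = sSup {r : ℝ | ∃ φ₁ : V₁, ‖φ₁‖ = 1 ∧ r = a φ₁ v₂})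
    (v₁ : V₁) (v₂ : V₂) : |a v₁ v₂| ≤ ‖v₁‖ * ‖v₂‖ := by
  have key : ∀ u : V₁, a u v₂ ≤ ‖u‖ * ‖v₂‖ := by
    intro u
    rcases eq_or_ne u 0 with rfl | hu
    · simp
    have hu' : 0 < ‖u‖ := norm_pos_iff.2 hu
    have hb : BddAbove {r : ℝ | ∃ φ₁ : V₁, ‖φ₁‖ = 1 ∧ r = a φ₁ v₂} := by
      refine ⟨‖a‖ * ‖v₂‖, ?_⟩
      rintro _ ⟨φ, hφ, rfl⟩
      have := a.le_opNorm₂ φ v₂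
      rw [hφ, mul_one] at this
      exact (le_abs_self _).trans this
    have h : a (‖u‖⁻¹ • u) v₂ ≤ ‖v₂‖ := by
      rw [hadj v₂]
      exact le_csSup hb ⟨_, norm_smul_inv_norm (𝕜 := ℝ) hu, rfl⟩
    rw [map_smul, smul_apply, smul_eq_mul, inv_mul_le_iff₀ hu'] at h
    exact h
  refine abs_le.2 ⟨?_, key _⟩
  have := key (-v₁)
  rw [map_neg, neg_apply, norm_neg] at this
  linarith

theorem abs_aV_le (a : V₁ →L[ℝ] V₂ →L[ℝ] ℝ) (ha : ∀ v₁ v₂, |a v₁ v₂| ≤ ‖v₁‖ * ‖v₂‖)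
    (v φ : V₁ × V₂) : |aV a v φ| ≤ nV v * nV φ := by
  have h := mul_add_mul_le_sqrt_mul_sqrt ‖v.1‖ ‖v.2‖ ‖φ.2‖ ‖φ.1‖
  rw [add_comm (‖φ.2‖ ^ 2)] at h
  calc |aV a v φ| ≤ |a v.1 φ.2| + |a φ.1 v.2| := abs_add_le _ _
    _ ≤ ‖v.1‖ * ‖φ.2‖ + ‖v.2‖ * ‖φ.1‖ := by
      rw [mul_comm ‖v.2‖]
      exact add_le_add (ha _ _) (ha _ _)
    _ ≤ _ := h

theorem sSup_unit_nonneg (f : V₂ →L[ℝ] ℝ) (S : Submodule ℝ V₂) :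
    0 ≤ sSup {s : ℝ | ∃ φ ∈ S, ‖φ‖ = 1 ∧ s = f φ} := by
  have hb : BddAbove {s : ℝ | ∃ φ ∈ S, ‖φ‖ = 1 ∧ s = f φ} := by
    refine ⟨‖f‖, ?_⟩
    rintro _ ⟨φ, -, hφ, rfl⟩
    have := f.le_opNorm φ
    rw [hφ, mul_one] at this
    exact (le_abs_self _).trans this
  rcases Set.eq_empty_or_nonempty {s : ℝ | ∃ φ ∈ S, ‖φ‖ = 1 ∧ s = f φ} with h | ⟨_, φ, hS, hφ, rfl⟩
  · rw [h, Real.sSup_empty]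
  · have h₁ := le_csSup hb ⟨φ, hS, hφ, rfl⟩
    have h₂ := le_csSup hb ⟨-φ, S.neg_mem hS, by rw [norm_neg, hφ], rfl⟩
    rw [map_neg] at h₂
    linarith

theorem discInfSup_le (a : V₁ →L[ℝ] V₂ →L[ℝ] ℝ) {S₁ : Submodule ℝ V₁} (S₂ : Submodule ℝ V₂)
    {v : V₁} (hv : v ∈ S₁) (hn : ‖v‖ = 1) :
    discInfSup a S₁ S₂ ≤ sSup {s : ℝ | ∃ φ₂ ∈ S₂, ‖φ₂‖ = 1 ∧ s = a v φ₂} := by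
  refine csInf_le ⟨0, ?_⟩ ⟨v, hv, hn, rfl⟩
  rintro _ ⟨u, -, -, rfl⟩
  exact sSup_unit_nonneg (a u) S₂

theorem discInfSup_mul_norm_le (a : V₁ →L[ℝ] V₂ →L[ℝ] ℝ) {S₁ : Submodule ℝ V₁}
    {S₂ : Submodule ℝ V₂} {v : V₁} (hv : v ∈ S₁) {C : ℝ} (hC : 0 ≤ C)
    (h : ∀ φ ∈ S₂, a v φ ≤ C * ‖φ‖) : discInfSup a S₁ S₂ * ‖v‖ ≤ C := by
  rcases eq_or_ne v 0 with rfl | h₀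
  · simpa using hC
  have hpos : 0 < ‖v‖ := norm_pos_iff.2 h₀
  rw [← le_div_iff₀ hpos]
  refine (discInfSup_le a S₂ (S₁.smul_mem ‖v‖⁻¹ hv) (norm_smul_inv_norm (𝕜 := ℝ) h₀)).trans ?_
  refine Real.sSup_le ?_ (by positivity)
  rintro _ ⟨φ, hφ, hn, rfl⟩
  have := h φ hφ
  rw [hn, mul_one] at this
  rw [map_smul, smul_apply, smul_eq_mul, div_eq_inv_mul]
  gcongr

theorem discInfSup_le_one (a : V₁ →L[ℝ] V₂ →L[ℝ] ℝ) (ha : ∀ v₁ v₂, |a v₁ v₂| ≤ ‖v₁‖ * ‖v₂‖)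
    (S₁ : Submodule ℝ V₁) (S₂ : Submodule ℝ V₂) : discInfSup a S₁ S₂ ≤ 1 := by
  by_cases hex : ∃ v ∈ S₁, ‖v‖ = 1
  · obtain ⟨v, hv, hn⟩ := hex
    have := discInfSup_mul_norm_le a (S₂ := S₂) hv zero_le_one
      (fun φ _ => by simpa [hn] using (le_abs_self _).trans (ha v φ))
    simpa [hn] using this
  · refine le_of_eq_of_le ((congrArg sInf (Set.eq_empty_of_forall_notMem ?_)).trans
      Real.sInf_empty) zero_le_one
    rintro _ ⟨v, hv, hn, -⟩
    exact hex ⟨v, hv, hn⟩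

/-- The discrete inf-sup condition for `a` carries over to the symmetric form `aV`. -/
theorem nV_le_of_forall_aV_le (a : V₁ →L[ℝ] V₂ →L[ℝ] ℝ) (S₁ : Submodule ℝ V₁)
    (S₂ : Submodule ℝ V₂) [FiniteDimensional ℝ S₁]
    (hnd₁ : ∀ v₁ ∈ S₁, (∀ φ₂ ∈ S₂, a v₁ φ₂ = 0) → v₁ = 0)
    (hnd₂ : ∀ v₂ ∈ S₂, (∀ φ₁ ∈ S₁, a φ₁ v₂ = 0) → v₂ = 0)
    {μ : ℝ} (hμ : 0 < μ) (hinf : 1 / μ = discInfSup a S₁ S₂) {w : V₁ × V₂}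
    (hw₁ : w.1 ∈ S₁) (hw₂ : w.2 ∈ S₂) {C : ℝ} (hC : 0 ≤ C)
    (h : ∀ φ : V₁ × V₂, φ.1 ∈ S₁ → φ.2 ∈ S₂ → aV a w φ ≤ C * nV φ) :
    nV w ≤ μ * C := by
  have bound : ∀ v ∈ S₁, ∀ D : ℝ, 0 ≤ D → (∀ φ ∈ S₂, a v φ ≤ D * ‖φ‖) → ‖v‖ ≤ μ * D := by
    intro v hv D hD hvD
    have := discInfSup_mul_norm_le a hv hD hvD
    rw [← hinf, one_div, inv_mul_le_iff₀ hμ] at this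
    exact this
  let B : S₁ →ₗ[ℝ] S₂ →ₗ[ℝ] ℝ := (a.toLinearMap₁₂).domRestrict₁₂ S₁ S₂
  have hB : B.IsPerfPair := by
    refine LinearMap.IsPerfPair.of_injective
      ((injective_iff_map_eq_zero B).2 fun v hv => ?_)
      ((injective_iff_map_eq_zero B.flip).2 fun v hv => ?_)
    · exact Subtype.ext (hnd₁ v v.2 fun φ hφ => LinearMap.congr_fun hv ⟨φ, hφ⟩)
    · exact Subtype.ext (hnd₂ v v.2 fun φ hφ => LinearMap.congr_fun hv ⟨φ, hφ⟩)
  obtain ⟨v₁, hv₁⟩ := hB.bijective_left.2 ((innerₗ V₂ w.2).domRestrict S₂)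
  obtain ⟨v₂, hv₂⟩ := hB.bijective_right.2 ((innerₗ V₁ w.1).domRestrict S₁)
  have e₁ : ∀ φ ∈ S₂, a v₁ φ = ⟪w.2, φ⟫ := fun φ hφ => LinearMap.congr_fun hv₁ ⟨φ, hφ⟩
  have e₂ : ∀ φ ∈ S₁, a φ v₂ = ⟪w.1, φ⟫ := fun φ hφ => LinearMap.congr_fun hv₂ ⟨φ, hφ⟩
  have n₁ : ‖(v₁ : V₁)‖ ≤ μ * ‖w.2‖ :=
    bound v₁ v₁.2 _ (norm_nonneg _) fun φ hφ => by
      rw [e₁ φ hφ]; exact real_inner_le_norm _ _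
  have n₂ : ‖(v₂ : V₂)‖ ≤ μ * ‖w.1‖ := by
    obtain ⟨u, hu⟩ := hB.bijective_left.2 ((innerₗ V₂ (v₂ : V₂)).domRestrict S₂)
    have e : ∀ φ ∈ S₂, a u φ = ⟪(v₂ : V₂), φ⟫ := fun φ hφ => LinearMap.congr_fun hu ⟨φ, hφ⟩
    have nu : ‖(u : V₁)‖ ≤ μ * ‖(v₂ : V₂)‖ :=
      bound u u.2 _ (norm_nonneg _) fun φ hφ => by
        rw [e φ hφ]; exact real_inner_le_norm _ _
    have h₁ : ‖(v₂ : V₂)‖ ^ 2 ≤ ‖w.1‖ * ‖(u : V₁)‖ := by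
      rw [← real_inner_self_eq_norm_sq, ← e v₂ v₂.2, e₂ u u.2]
      exact real_inner_le_norm _ _
    rcases (norm_nonneg (v₂ : V₂)).eq_or_lt with h₀ | h₀
    · rw [← h₀]; positivity
    · refine le_of_mul_le_mul_right ?_ h₀
      nlinarith [mul_le_mul_of_nonneg_left nu (norm_nonneg w.1)]
  have ht := h ((v₁ : V₁), (v₂ : V₂)) v₁.2 v₂.2
  have e : aV a w ((v₁ : V₁), (v₂ : V₂)) = nV w ^ 2 := by
    rw [nV_sq, aV, e₁ _ hw₂, e₂ _ hw₁, real_inner_self_eq_norm_sq, real_inner_self_eq_norm_sq]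
  have hn : nV ((v₁ : V₁), (v₂ : V₂)) ≤ μ * nV w := by
    refine Real.sqrt_le_iff.2 ⟨mul_nonneg hμ.le (nV_nonneg _), ?_⟩
    rw [mul_pow, nV_sq]
    have s₁ := pow_le_pow_left₀ (norm_nonneg _) n₁ 2
    have s₂ := pow_le_pow_left₀ (norm_nonneg _) n₂ 2
    rw [mul_pow] at s₁ s₂
    linarith
  rw [e] at ht
  rcases (nV_nonneg w).eq_or_lt with h₀ | h₀
  · rw [← h₀]; positivity
  · refine le_of_mul_le_mul_right ?_ h₀
    nlinarith [mul_le_mul_of_nonneg_left hn hC]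

end InfSup

/-- The scalar inequality that turns the coupled bounds on `n = ‖w‖` and the weighted
pseudometric `y` into the explicit constant `κ_h`. -/
theorem add_le_of_le_of_sq_le {M L μ D n y : ℝ} (hM : 0 ≤ M) (hL : 0 ≤ L) (hμ : 1 ≤ μ)
    (hD : 0 ≤ D) (hn : n ≤ μ * (D + y)) (hyn : y ^ 2 ≤ L * M * D * n) :
    n + y ≤ (1 + 2 * L) / (1 + L) * (1 + M * (1 + 2 * L) * μ) * μ * D := by
  have hL₁ : 0 < 1 + L := by linarith
  obtain ⟨m, hm⟩ : ∃ m, m = M * μ := ⟨_, rfl⟩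
  have hm₀ : 0 ≤ m := by rw [hm]; positivity
  obtain ⟨T, hT⟩ : ∃ T, T = (L + m * (1 + 2 * L) ^ 2) / (2 * (1 + L)) := ⟨_, rfl⟩
  have hT₀ : 0 ≤ T := by rw [hT]; positivity
  have hTκ : (1 + 2 * L) / (1 + L) * (1 + M * (1 + 2 * L) * μ) = 1 + 2 * T := by
    rw [hT, hm]; field_simp; ring
  have hTc : m * L ≤ T := by
    rw [hT, le_div_iff₀ (by positivity)]
    nlinarith [mul_nonneg hm₀ hL, mul_nonneg (mul_nonneg hm₀ hL) hL]
  have hTq : m * L * (1 + T) ≤ T ^ 2 := by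
    have hx : 2 * (1 + L) * T = L + m * (1 + 2 * L) ^ 2 := by rw [hT]; field_simp
    have hpos : 0 < (2 * (1 + L)) ^ 2 := by positivity
    refine le_of_mul_le_mul_left ?_ hpos
    have e : (2 * (1 + L)) ^ 2 * T ^ 2 - (2 * (1 + L)) ^ 2 * (m * L * (1 + T)) =
        (L - (1 + L) * m) ^ 2 + 2 * L ^ 3 * m +
          ((1 + 2 * L) ^ 2 * (1 + 2 * L + 2 * L ^ 2) - (1 + L) ^ 2) * m ^ 2 := by
      have : (2 * (1 + L)) ^ 2 * T ^ 2 - (2 * (1 + L)) ^ 2 * (m * L * (1 + T)) =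
        (2 * (1 + L) * T) ^ 2 - 4 * (1 + L) ^ 2 * m * L -
          2 * (1 + L) * m * L * (2 * (1 + L) * T) := by ring
      rw [this, hx]; ring
    have : 0 ≤ (1 + 2 * L) ^ 2 * (1 + 2 * L + 2 * L ^ 2) - (1 + L) ^ 2 := by
      ring_nf; positivity
    have : 0 ≤ (L - (1 + L) * m) ^ 2 + 2 * L ^ 3 * m +
          ((1 + 2 * L) ^ 2 * (1 + 2 * L + 2 * L ^ 2) - (1 + L) ^ 2) * m ^ 2 := by positivity
    linarith
  have hq : y ^ 2 ≤ m * L * D * (D + y) := by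
    calc y ^ 2 ≤ L * M * D * n := hyn
      _ ≤ L * M * D * (μ * (D + y)) := by gcongr
      _ = _ := by rw [hm]; ring
  have hyT : y ≤ T * D := by
    by_contra! hlt
    have h₁ : 0 ≤ T * D := by positivity
    have h₂ : 0 ≤ (T - m * L) * D := mul_nonneg (by linarith) hD
    have h₃ : T * D * ((T - m * L) * D) < y * (y - m * L * D) := by
      nlinarith
    nlinarith [mul_le_mul_of_nonneg_right hTq (sq_nonneg D)]
  rw [hTκ]
  have : T * D ≤ μ * (T * D) := le_mul_of_one_le_left (by positivity) hμ
  nlinarith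

/-- Theorem 5.4, non-asymptotic quasi-best approximation with control
constraints: `d_{K,α}(x,x_h) ≤ (κ_h μ_h + 1) inf_{v_h ∈ V_h} d_{K,α}(x,v_h)`. -/
theorem stmt16
    {V₁ V₂ Q W : Type*}
    [NormedAddCommGroup V₁] [InnerProductSpace ℝ V₁] [CompleteSpace V₁] [Nontrivial V₁]
    [NormedAddCommGroup V₂] [InnerProductSpace ℝ V₂] [CompleteSpace V₂] [Nontrivial V₂]
    [NormedAddCommGroup Q] [InnerProductSpace ℝ Q] [CompleteSpace Q]
    [NormedAddCommGroup W] [InnerProductSpace ℝ W] [CompleteSpace W]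
    (a : V₁ →L[ℝ] V₂ →L[ℝ] ℝ) (Cs : V₂ →L[ℝ] Q) (Iop : V₁ →L[ℝ] W)
    (α m_a M_C M_I M L : ℝ) (hα : 0 < α)
    (hma : m_a = infSupConst a) (hma_pos : 0 < m_a)
    (hnd : ∀ v₁ : V₁, (∀ v₂ : V₂, a v₁ v₂ = 0) → v₁ = 0)
    (hadj : ∀ v₂ : V₂, ‖v₂‖ = sSup {r : ℝ | ∃ φ₁ : V₁, ‖φ₁‖ = 1 ∧ r = a φ₁ v₂})
    (hMC : M_C = ‖Cs‖) (hMI : M_I = ‖Iop‖) (hM : M = max M_I M_C)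
    (hL : L = M / Real.sqrt α)
    (K : Set Q) (hK_ne : K.Nonempty) (hK_cl : IsClosed K) (hK_cx : Convex ℝ K)
    (PK : Q → Q) (hPK_mem : ∀ q, PK q ∈ K)
    (hPK : ∀ q : Q, ∀ p ∈ K, ‖q - PK q‖ ≤ ‖q - p‖)
    (Vh1 : Submodule ℝ V₁) (Vh2 : Submodule ℝ V₂)
    [FiniteDimensional ℝ Vh1] [FiniteDimensional ℝ Vh2]
    (hndh1 : ∀ v₁ ∈ Vh1, (∀ φ₂ ∈ Vh2, a v₁ φ₂ = 0) → v₁ = 0)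
    (hndh2 : ∀ v₂ ∈ Vh2, (∀ φ₁ ∈ Vh1, a φ₁ v₂ = 0) → v₂ = 0)
    (μh κh : ℝ) (hμh_pos : 0 < μh)
    (hμh : 1 / μh = discInfSup a Vh1 Vh2)
    (hκh : κh = ((1 + 2 * L) / (1 + L)) * (1 + M * (1 + 2 * M / Real.sqrt α) * μh))
    (u_d : W) (x xh : V₁ × V₂)
    (hx : ∀ φ : V₁ × V₂, bK a Cs Iop PK α x φ = -(Real.sqrt α)⁻¹ * ⟪u_d, Iop φ.1⟫)
    (hxh_mem : xh.1 ∈ Vh1 ∧ xh.2 ∈ Vh2)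
    (hxh : ∀ φh : V₁ × V₂, φh.1 ∈ Vh1 → φh.2 ∈ Vh2 →
      bK a Cs Iop PK α xh φh = -(Real.sqrt α)⁻¹ * ⟪u_d, Iop φh.1⟫) :
    nV (x - xh) + (M / Real.sqrt α) * deltaK Cs Iop PK α x xh ≤
      (κh * μh + 1) *
        sInf {r : ℝ | ∃ vh : V₁ × V₂, vh.1 ∈ Vh1 ∧ vh.2 ∈ Vh2 ∧
          r = nV (x - vh) + (M / Real.sqrt α) * deltaK Cs Iop PK α x vh} := by
  have hr : 0 < √α := Real.sqrt_pos.2 hα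
  have hCM : ‖Cs‖ ≤ M := by rw [hM, ← hMC]; exact le_max_right _ _
  have hIM : ‖Iop‖ ≤ M := by rw [hM, ← hMI]; exact le_max_left _ _
  have hM₀ : 0 ≤ M := (norm_nonneg _).trans hCM
  have hL₀ : 0 ≤ L := by rw [hL]; positivity
  have ha := abs_le_of_adjointNorm a hadj
  have hμ₁ : 1 ≤ μh := by
    have := discInfSup_le_one a ha Vh1 Vh2
    rwa [← hμh, div_le_one hμh_pos] at this
  rw [mul_div_assoc, ← hL] at hκh
  have hκ₀ : 0 ≤ κh := by rw [hκh]; positivity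
  rw [← hL]
  have main : ∀ vh : V₁ × V₂, vh.1 ∈ Vh1 → vh.2 ∈ Vh2 →
      nV (x - xh) + L * deltaK Cs Iop PK α x xh ≤
        (κh * μh + 1) * (nV (x - vh) + L * deltaK Cs Iop PK α x vh) := by
    intro vh hv₁ hv₂
    set D := nV (x - vh) + L * deltaK Cs Iop PK α x vh with hDdef
    have hD₀ : 0 ≤ D :=
      add_nonneg (nV_nonneg _) (mul_nonneg hL₀ (deltaK_nonneg _ _ _ _ _ _))
    set δ := deltaK Cs Iop PK α vh xh with hδ
    have hδ₀ : 0 ≤ δ := deltaK_nonneg _ _ _ _ _ _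
    have hw₁ : (vh - xh).1 ∈ Vh1 := Vh1.sub_mem hv₁ hxh_mem.1
    have hw₂ : (vh - xh).2 ∈ Vh2 := Vh2.sub_mem hv₂ hxh_mem.2
    have hsub : ∀ v w φ : V₁ × V₂, aV a (v - w) φ = aV a v φ - aV a w φ := by
      intro v w φ
      simp only [aV, Prod.fst_sub, Prod.snd_sub, map_sub, sub_apply]
      ring
    have hres : ∀ φ : V₁ × V₂, φ.1 ∈ Vh1 → φ.2 ∈ Vh2 →
        aV a (vh - xh) φ + (cK Cs Iop PK α vh φ - cK Cs Iop PK α xh φ) ≤ D * nV φ := by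
      intro φ h₁ h₂
      have horth := (hx φ).trans (hxh φ h₁ h₂).symm
      simp only [bK] at horth
      have b₁ := (le_abs_self _).trans (abs_aV_le a ha (vh - x) φ)
      have b₂ := (le_abs_self _).trans (abs_cK_sub_le Cs Iop PK hα hCM hIM vh x φ)
      rw [nV_sub_comm] at b₁
      rw [← hL, deltaK_comm] at b₂
      rw [hsub] at b₁ ⊢
      rw [hDdef, add_mul]
      linarith
    have hn : nV (vh - xh) ≤ μh * (D + L * δ) := by
      refine nV_le_of_forall_aV_le a Vh1 Vh2 hndh1 hndh2 hμh_pos hμh hw₁ hw₂ (by positivity) ?_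
      intro φ h₁ h₂
      have b₁ := hres φ h₁ h₂
      have b₂ := (neg_le_abs _).trans (abs_cK_sub_le Cs Iop PK hα hCM hIM vh xh φ)
      rw [← hL, ← hδ] at b₂
      rw [add_mul]
      linarith
    have hsq : δ ^ 2 ≤ √α * (D * nV (vh - xh)) := by
      refine (deltaK_sq_le Cs Iop hK_cx hPK_mem hPK hα vh xh).trans ?_
      have b := hres (-(vh - xh).1, (vh - xh).2) (Vh1.neg_mem hw₁) hw₂
      have e : aV a (vh - xh) (-(vh - xh).1, (vh - xh).2) = 0 := by
        simp only [aV, map_neg, neg_apply, add_neg_cancel]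
      have e' : nV (-(vh - xh).1, (vh - xh).2) = nV (vh - xh) := by
        simp only [nV, norm_neg]
      rw [e, zero_add, e'] at b
      exact mul_le_mul_of_nonneg_left b hr.le
    have hyn : (L * δ) ^ 2 ≤ L * M * D * nV (vh - xh) := by
      have hLr : L * √α = M := by rw [hL]; field_simp
      calc (L * δ) ^ 2 = L ^ 2 * δ ^ 2 := mul_pow _ _ _
        _ ≤ L ^ 2 * (√α * (D * nV (vh - xh))) := by gcongr
        _ = L * (L * √α) * D * nV (vh - xh) := by ring
        _ = _ := by rw [hLr]
    have hfin := add_le_of_le_of_sq_le hM₀ hL₀ hμ₁ hD₀ hn hyn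
    rw [← hκh] at hfin
    have t₁ := nV_add_le (x - vh) (vh - xh)
    rw [sub_add_sub_cancel] at t₁
    have t₂ := mul_le_mul_of_nonneg_left (deltaK_triangle Cs Iop PK hα x vh xh) hL₀
    linarith
  have hk : 0 < κh * μh + 1 := by positivity
  rw [← div_le_iff₀' hk]
  refine le_csInf ⟨_, 0, Vh1.zero_mem, Vh2.zero_mem, rfl⟩ ?_
  rintro _ ⟨vh, h₁, h₂, rfl⟩
  rw [div_le_iff₀' hk]
  exact main vh h₁ h₂
end

section
/- Assume I : V₁ → W and C* : V₂ → Q are compact, uniform stability (μ_h ≤ μ̄ for all h > 0) and approximability (for every v ∈ V, inf_{v_h ∈ V_h}‖v − v_h‖ → 0 as h → 0); set κ̄ = ((1+2L)/(1+L))·(1 + M(1 + 2M/√α)·μ̄) with L = M/√α. Then there exists ε : (0,∞) → [0,∞) with ε(h) → 0 as h → 0, independent of u_d, such that for every u_d ∈ W, the solution x ∈ V of b_K(x,φ) = −α^{−1/2}⟨u_d, Iφ₁⟩_W for all φ ∈ V and its discrete approximations x_h ∈ V_h, solving b_K(x_h,φ_h) = −α^{−1/2}⟨u_d, Iφ_{h,1}⟩_W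 for all φ_h ∈ V_h, satisfy ‖x − x_h‖ ≤ μ_h·(1 + (M/√α)·κ̄·ε(h))·inf_{v_h ∈ V_h}‖x − v_h‖ for all h (asymptotic quasi-best approximation with control constraints). -/
open scoped RealInnerProductSpace
open Filter Topology

section Hilbert

variable {E F : Type*} [NormedAddCommGroup E] [InnerProductSpace ℝ E]
  [NormedAddCommGroup F] [InnerProductSpace ℝ F]

/-- In an inner product space, a bound `≥ 1` for a projection also bounds the complementary
projection. -/
theorem norm_complement_le_of_norm_projection_le {U N : Submodule ℝ E} {c : ℝ} (hc : 1 ≤ c)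
    (h : ∀ u ∈ U, ∀ w ∈ N, ‖u‖ ≤ c * ‖u + w‖) {u w : E} (hu : u ∈ U) (hw : w ∈ N) :
    ‖w‖ ≤ c * ‖u + w‖ := by
  rcases eq_or_ne u 0 with rfl | hu0
  · simpa using le_mul_of_one_le_left (norm_nonneg w) hc
  rcases eq_or_ne w 0 with rfl | hw0
  · simpa using mul_nonneg (zero_le_one.trans hc) (norm_nonneg u)
  have hu' := norm_pos_iff.2 hu0
  have hw' := norm_pos_iff.2 hw0
  have key := h _ (U.smul_mem (‖w‖ / ‖u‖) hu) _ (N.smul_mem (‖u‖ / ‖w‖) hw)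
  have h1 : ‖(‖w‖ / ‖u‖) • u‖ = ‖w‖ := by
    rw [norm_smul, Real.norm_of_nonneg (by positivity)]; field_simp
  have h2 : ‖(‖u‖ / ‖w‖) • w‖ = ‖u‖ := by
    rw [norm_smul, Real.norm_of_nonneg (by positivity)]; field_simp
  have h3 : ‖(‖w‖ / ‖u‖) • u + (‖u‖ / ‖w‖) • w‖ = ‖u + w‖ := by
    rw [← sq_eq_sq₀ (norm_nonneg _) (norm_nonneg _), norm_add_sq_real, norm_add_sq_real, h1, h2,
      real_inner_smul_left, real_inner_smul_right]
    field_simp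
    ring
  rwa [h1, h3] at key

/-- A compact operator turns weak convergence to zero, uniform over bounded sets `N i`, into norm
convergence to zero. -/
theorem IsCompactOperator.eventually_norm_le {ι : Type*} {l : Filter ι} {T : E →L[ℝ] F}
    (hT : IsCompactOperator T) {N : ι → Set E} (hN : ∀ i, ∀ v ∈ N i, ‖v‖ ≤ 1)
    (hweak : ∀ s : F, ∀ c > 0, ∀ᶠ i in l, ∀ v ∈ N i, ⟪s, T v⟫ ≤ c) {c : ℝ} (hc : 0 < c) :
    ∀ᶠ i in l, ∀ v ∈ N i, ‖T v‖ ≤ c := by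
  have htb : TotallyBounded (T '' Metric.closedBall 0 1) :=
    (hT.isCompact_closure_image_closedBall 1).totallyBounded.subset subset_closure
  obtain ⟨t, ht, hcover⟩ := Metric.totallyBounded_iff.1 htb (c / 2) (by positivity)
  filter_upwards [(ht.eventually_all).2 fun s _ => hweak s (c ^ 2 / 2) (by positivity)]
    with i hi v hv
  obtain ⟨s, hs, hvs⟩ := Set.mem_iUnion₂.1
    (hcover ⟨v, by simpa using hN i v hv, rfl⟩)
  have h1 : ‖T v - s‖ < c / 2 := by simpa [dist_eq_norm] using hvs
  have h2 : ⟪T v - s, T v⟫ ≤ ‖T v - s‖ * ‖T v‖ := real_inner_le_norm _ _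
  have h3 := hi s hs v hv
  rw [inner_sub_left, real_inner_self_eq_norm_sq] at h2
  nlinarith [norm_nonneg (T v)]

/-- Metric projections onto convex sets are firmly nonexpansive. -/
theorem norm_sq_sub_le_inner_of_metric_projection {K : Set E} (hK : Convex ℝ K) {P : E → E}
    (hmem : ∀ q, P q ∈ K) (hmin : ∀ q, ∀ p ∈ K, ‖q - P q‖ ≤ ‖q - p‖) (u v : E) :
    ‖P u - P v‖ ^ 2 ≤ ⟪P u - P v, u - v⟫ := by
  have hvar : ∀ q, ∀ p ∈ K, ⟪q - P q, p - P q⟫ ≤ 0 := by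
    intro q
    have : Nonempty K := ⟨⟨P q, hmem q⟩⟩
    refine (norm_eq_iInf_iff_real_inner_le_zero hK (hmem q)).1 (le_antisymm ?_ ?_)
    · exact le_ciInf fun p => hmin q p p.2
    · exact ciInf_le ⟨0, by rintro _ ⟨p, rfl⟩; positivity⟩ (⟨P q, hmem q⟩ : K)
  have h1 := hvar u (P v) (hmem v)
  have h2 := hvar v (P u) (hmem u)
  have h3 : ⟪P u - P v, u - v⟫ - ‖P u - P v‖ ^ 2
      = -(⟪u - P u, P v - P u⟫ + ⟪v - P v, P u - P v⟫) := by
    rw [← real_inner_self_eq_norm_sq]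
    simp only [inner_sub_left, inner_sub_right, real_inner_comm]
    ring
  linarith

end Hilbert

section ProductNorm

variable {V₁ V₂ : Type*} [NormedAddCommGroup V₁] [NormedAddCommGroup V₂]

theorem nV_eq_norm_toLp (v : V₁ × V₂) : nV v = ‖WithLp.toLp 2 v‖ := by
  rw [WithLp.prod_norm_eq_of_L2]; rfl

theorem nV_nonneg_s19 (v : V₁ × V₂) : 0 ≤ nV v := Real.sqrt_nonneg _

theorem nV_sub_le (v w : V₁ × V₂) : nV (v - w) ≤ nV v + nV w := by
  simp only [nV_eq_norm_toLp, WithLp.toLp_sub]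
  exact norm_sub_le _ _

theorem norm_fst_le_nV (v : V₁ × V₂) : ‖v.1‖ ≤ nV v :=
  Real.le_sqrt_of_sq_le (by nlinarith [sq_nonneg ‖v.2‖])

theorem norm_snd_le_nV (v : V₁ × V₂) : ‖v.2‖ ≤ nV v :=
  Real.le_sqrt_of_sq_le (by nlinarith [sq_nonneg ‖v.1‖])

variable [InnerProductSpace ℝ V₁] [InnerProductSpace ℝ V₂]

theorem nV_smul (c : ℝ) (v : V₁ × V₂) : nV (c • v) = |c| * nV v := by
  simp only [nV_eq_norm_toLp, WithLp.toLp_smul, norm_smul, Real.norm_eq_abs]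

theorem bestErr_nonneg (U₁ : Submodule ℝ V₁) (U₂ : Submodule ℝ V₂) (x : V₁ × V₂) :
    0 ≤ bestErr U₁ U₂ x :=
  Real.sInf_nonneg (by rintro _ ⟨_, _, _, rfl⟩; exact nV_nonneg_s19 _)

theorem le_bestErr {U₁ : Submodule ℝ V₁} {U₂ : Submodule ℝ V₂} {x : V₁ × V₂} {c : ℝ}
    (h : ∀ v : V₁ × V₂, v.1 ∈ U₁ → v.2 ∈ U₂ → c ≤ nV (x - v)) : c ≤ bestErr U₁ U₂ x :=
  le_csInf ⟨_, 0, U₁.zero_mem, U₂.zero_mem, rfl⟩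
    (by rintro _ ⟨v, h1, h2, rfl⟩; exact h v h1 h2)

theorem le_mul_bestErr {U₁ : Submodule ℝ V₁} {U₂ : Submodule ℝ V₂} {x : V₁ × V₂} {b c : ℝ}
    (hc : 0 < c) (h : ∀ v : V₁ × V₂, v.1 ∈ U₁ → v.2 ∈ U₂ → b ≤ c * nV (x - v)) :
    b ≤ c * bestErr U₁ U₂ x := by
  rw [← div_le_iff₀' hc]
  exact le_bestErr fun v h1 h2 => (div_le_iff₀' hc).2 (h v h1 h2)

end ProductNorm

section AdjointNorm

variable {V₁ V₂ : Type*}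
  [NormedAddCommGroup V₁] [InnerProductSpace ℝ V₁] [NormedAddCommGroup V₂] [InnerProductSpace ℝ V₂]
  {a : V₁ →L[ℝ] V₂ →L[ℝ] ℝ}

theorem apply_le_of_adjointNorm
    (hadj : ∀ v₂ : V₂, ‖v₂‖ = sSup {r : ℝ | ∃ φ₁ : V₁, ‖φ₁‖ = 1 ∧ r = a φ₁ v₂})
    (φ₁ : V₁) (v₂ : V₂) : a φ₁ v₂ ≤ ‖φ₁‖ * ‖v₂‖ := by
  rcases eq_or_ne φ₁ 0 with rfl | h0
  · simp
  have hpos := norm_pos_iff.2 h0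
  have hbdd : BddAbove {r : ℝ | ∃ φ₁ : V₁, ‖φ₁‖ = 1 ∧ r = a φ₁ v₂} := by
    refine ⟨‖a‖ * ‖v₂‖, ?_⟩
    rintro _ ⟨φ, hφ, rfl⟩
    simpa [hφ] using (le_abs_self _).trans (a.le_opNorm₂ φ v₂)
  have h1 : a (‖φ₁‖⁻¹ • φ₁) v₂ ≤ ‖v₂‖ := by
    rw [hadj v₂]
    exact le_csSup hbdd ⟨_, norm_smul_inv_norm h0, rfl⟩
  rw [map_smul, smul_apply, smul_eq_mul] at h1
  rwa [inv_mul_le_iff₀ hpos] at h1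

theorem norm_le_of_adjointNorm
    (hadj : ∀ v₂ : V₂, ‖v₂‖ = sSup {r : ℝ | ∃ φ₁ : V₁, ‖φ₁‖ = 1 ∧ r = a φ₁ v₂})
    {v₂ : V₂} {c : ℝ} (hc : 0 ≤ c) (h : ∀ φ₁, a φ₁ v₂ ≤ c * ‖φ₁‖) : ‖v₂‖ ≤ c := by
  rw [hadj v₂]
  refine Real.sSup_le ?_ hc
  rintro _ ⟨φ, hφ, rfl⟩
  simpa [hφ] using h φ

/-- With the adjoint norm on `V₂`, a form that is nondegenerate in the first argument is
represented by a surjective isometry `V₂ → V₁`. -/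
theorem exists_linearIsometryEquiv_of_adjointNorm [CompleteSpace V₁] [CompleteSpace V₂]
    (hnd : ∀ v₁ : V₁, (∀ v₂ : V₂, a v₁ v₂ = 0) → v₁ = 0)
    (hadj : ∀ v₂ : V₂, ‖v₂‖ = sSup {r : ℝ | ∃ φ₁ : V₁, ‖φ₁‖ = 1 ∧ r = a φ₁ v₂}) :
    ∃ B : V₂ ≃ₗᵢ[ℝ] V₁, ∀ v₁ v₂, a v₁ v₂ = ⟪B v₂, v₁⟫ := by
  let B₀ : V₂ →ₗ[ℝ] V₁ :=
    (InnerProductSpace.toDual ℝ V₁).symm.toLinearEquiv.toLinearMap.comp a.flip.toLinearMap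
  have hB₀ : ∀ v₁ v₂, a v₁ v₂ = ⟪B₀ v₂, v₁⟫ := fun v₁ v₂ => by
    simp [B₀]
  let B : V₂ →ₗᵢ[ℝ] V₁ := ⟨B₀, fun v₂ => le_antisymm
    (by
      rcases eq_or_ne (B₀ v₂) 0 with h0 | h0
      · simp [h0]
      have h := apply_le_of_adjointNorm hadj (B₀ v₂) v₂
      rw [hB₀, real_inner_self_eq_norm_mul_norm] at h
      exact le_of_mul_le_mul_left h (norm_pos_iff.2 h0))
    (norm_le_of_adjointNorm hadj (norm_nonneg _) fun φ => by
      rw [hB₀]; exact real_inner_le_norm _ _)⟩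
  have hclosed : IsClosed (LinearMap.range B.toLinearMap : Set V₁) := by
    rw [LinearMap.coe_range]
    exact B.isometry.isClosedEmbedding.isClosed_range
  have : CompleteSpace (LinearMap.range B.toLinearMap) := hclosed.completeSpace_coe
  have hsurj : Function.Surjective B := by
    rw [← LinearIsometry.coe_toLinearMap, ← LinearMap.range_eq_top,
      ← Submodule.orthogonal_eq_bot_iff, Submodule.eq_bot_iff]
    intro v hv
    refine hnd v fun v₂ => ?_
    rw [hB₀]
    exact (Submodule.mem_orthogonal _ _).1 hv _ ⟨v₂, rfl⟩
  exact ⟨LinearIsometryEquiv.ofSurjective B hsurj, fun v₁ v₂ => hB₀ v₁ v₂⟩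

end AdjointNorm

section Discrete

variable {V₁ V₂ : Type*}
  [NormedAddCommGroup V₁] [InnerProductSpace ℝ V₁] [NormedAddCommGroup V₂] [InnerProductSpace ℝ V₂]
  {a : V₁ →L[ℝ] V₂ →L[ℝ] ℝ} {U₁ : Submodule ℝ V₁} {U₂ : Submodule ℝ V₂} {μ : ℝ}

theorem norm_le_of_discInfSup (hμ_pos : 0 < μ) (hμ : 1 / μ = discInfSup a U₁ U₂)
    {r : V₁} (hr : r ∈ U₁) {c : ℝ} (hc : 0 ≤ c) (h : ∀ φ ∈ U₂, a r φ ≤ c * ‖φ‖) :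
    ‖r‖ ≤ μ * c := by
  rcases eq_or_ne r 0 with rfl | h0
  · simpa using by positivity
  have hpos := norm_pos_iff.2 h0
  have hbdd : BddBelow {r : ℝ | ∃ v₁ ∈ U₁, ‖v₁‖ = 1 ∧
      r = sSup {s : ℝ | ∃ φ₂ ∈ U₂, ‖φ₂‖ = 1 ∧ s = a v₁ φ₂}} := by
    refine ⟨0, ?_⟩
    rintro _ ⟨v, -, -, rfl⟩
    by_cases hne : ∃ φ ∈ U₂, ‖φ‖ = 1
    · obtain ⟨φ, hφ, hφ1⟩ := hne
      refine Real.sSup_nonneg' ?_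
      rcases le_total 0 (a v φ) with h' | h'
      · exact ⟨_, ⟨φ, hφ, hφ1, rfl⟩, h'⟩
      · exact ⟨_, ⟨-φ, U₂.neg_mem hφ, by simpa using hφ1, rfl⟩, by simpa using h'⟩
    · refine Real.sSup_nonneg ?_
      rintro _ ⟨φ, hφ, hφ1, -⟩
      exact absurd ⟨φ, hφ, hφ1⟩ hne
  have h1 : 1 / μ ≤ ‖r‖⁻¹ * c := by
    rw [hμ]
    refine (csInf_le hbdd ⟨‖r‖⁻¹ • r, U₁.smul_mem _ hr, norm_smul_inv_norm h0, rfl⟩).trans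
      (Real.sSup_le ?_ (by positivity))
    rintro _ ⟨φ, hφ, hφ1, rfl⟩
    rw [map_smul, smul_apply, smul_eq_mul]
    have := h φ hφ
    rw [hφ1, mul_one] at this
    gcongr
  rw [div_le_iff₀ hμ_pos, mul_assoc, ← div_eq_inv_mul, le_div_iff₀ hpos] at h1
  linarith

theorem one_le_of_discInfSup
    (hadj : ∀ v₂ : V₂, ‖v₂‖ = sSup {r : ℝ | ∃ φ₁ : V₁, ‖φ₁‖ = 1 ∧ r = a φ₁ v₂})
    (hμ_pos : 0 < μ) (hμ : 1 / μ = discInfSup a U₁ U₂) : 1 ≤ μ := by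
  by_cases hne : ∃ v ∈ U₁, ‖v‖ = 1
  · obtain ⟨v, hv, hv1⟩ := hne
    have := norm_le_of_discInfSup hμ_pos hμ hv zero_le_one fun φ _ => by
      simpa [hv1] using apply_le_of_adjointNorm hadj v φ
    simpa [hv1] using this
  · have h0 : discInfSup a U₁ U₂ = 0 := by
      unfold discInfSup
      convert Real.sInf_empty
      rw [Set.eq_empty_iff_forall_notMem]
      rintro _ ⟨v, hv, hv1, -⟩
      exact hne ⟨v, hv, hv1⟩
    rw [h0] at hμ
    exact absurd hμ (by positivity)

/-- Existence of Galerkin projections for a nondegenerate pairing of finite-dimensional spaces. -/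
theorem exists_galerkin_projection [FiniteDimensional ℝ U₁] [FiniteDimensional ℝ U₂]
    (hnd1 : ∀ v₁ ∈ U₁, (∀ φ₂ ∈ U₂, a v₁ φ₂ = 0) → v₁ = 0)
    (hnd2 : ∀ v₂ ∈ U₂, (∀ φ₁ ∈ U₁, a φ₁ v₂ = 0) → v₂ = 0) :
    (∀ v : V₁, ∃ r ∈ U₁, ∀ φ ∈ U₂, a (v - r) φ = 0) ∧
      ∀ v : V₂, ∃ r ∈ U₂, ∀ φ ∈ U₁, a φ (v - r) = 0 := by
  let b : U₁ →ₗ[ℝ] U₂ →ₗ[ℝ] ℝ := LinearMap.mk₂ ℝ (fun u w => a u w)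
    (by simp) (by simp) (by simp) (by simp)
  have hb : ∀ u w, b u w = a u w := fun _ _ => rfl
  have hperf : b.IsPerfPair := by
    refine LinearMap.IsPerfPair.of_injective ?_ ?_
    · refine (injective_iff_map_eq_zero b).2 fun u hu => ?_
      exact Subtype.ext (hnd1 u u.2 fun φ hφ => LinearMap.congr_fun hu ⟨φ, hφ⟩)
    · refine (injective_iff_map_eq_zero b.flip).2 fun u hu => ?_
      exact Subtype.ext (hnd2 u u.2 fun φ hφ => LinearMap.congr_fun hu ⟨φ, hφ⟩)
  constructor
  · intro v
    obtain ⟨r, hr⟩ := (LinearMap.IsPerfPair.bijective_left b).2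
      ((a v).toLinearMap.comp U₂.subtype)
    refine ⟨r, r.2, fun φ hφ => ?_⟩
    have := LinearMap.congr_fun hr ⟨φ, hφ⟩
    simp only [hb] at this
    simp [this]
  · intro v
    obtain ⟨r, hr⟩ := (LinearMap.IsPerfPair.bijective_right b).2
      ((a.flip v).toLinearMap.comp U₁.subtype)
    refine ⟨r, r.2, fun φ hφ => ?_⟩
    have := LinearMap.congr_fun hr ⟨φ, hφ⟩
    simp only [LinearMap.flip_apply, hb] at this
    simp [this]

/-- Stability of the Galerkin projection onto `U₁`. -/
theorem norm_galerkin_fst_le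
    (hadj : ∀ v₂ : V₂, ‖v₂‖ = sSup {r : ℝ | ∃ φ₁ : V₁, ‖φ₁‖ = 1 ∧ r = a φ₁ v₂})
    (hμ_pos : 0 < μ) (hμ : 1 / μ = discInfSup a U₁ U₂)
    {v r : V₁} (hr : r ∈ U₁) (hvr : ∀ φ ∈ U₂, a (v - r) φ = 0) : ‖r‖ ≤ μ * ‖v‖ := by
  refine norm_le_of_discInfSup hμ_pos hμ hr (norm_nonneg v) fun φ hφ => ?_
  have := hvr φ hφ
  rw [map_sub, sub_apply, sub_eq_zero] at this
  rw [← this]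
  exact apply_le_of_adjointNorm hadj v φ

/-- The inf-sup bound for the first argument transfers to the second argument. -/
theorem norm_snd_le_of_discInfSup
    (hadj : ∀ v₂ : V₂, ‖v₂‖ = sSup {r : ℝ | ∃ φ₁ : V₁, ‖φ₁‖ = 1 ∧ r = a φ₁ v₂})
    (hμ_pos : 0 < μ) (hμ : 1 / μ = discInfSup a U₁ U₂)
    (hproj : ∀ v : V₁, ∃ r ∈ U₁, ∀ φ ∈ U₂, a (v - r) φ = 0)
    {r : V₂} (hr : r ∈ U₂) {c : ℝ} (hc : 0 ≤ c) (h : ∀ φ ∈ U₁, a φ r ≤ c * ‖φ‖) :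
    ‖r‖ ≤ μ * c := by
  refine norm_le_of_adjointNorm hadj (by positivity) fun φ => ?_
  obtain ⟨p, hp, hφp⟩ := hproj φ
  have h1 := hφp r hr
  rw [map_sub, sub_apply, sub_eq_zero] at h1
  have h2 := norm_galerkin_fst_le hadj hμ_pos hμ hp hφp
  calc a φ r = a p r := h1
    _ ≤ c * ‖p‖ := h p hp
    _ ≤ c * (μ * ‖φ‖) := by gcongr
    _ = μ * c * ‖φ‖ := by ring

theorem norm_sub_galerkin_fst_le
    (hadj : ∀ v₂ : V₂, ‖v₂‖ = sSup {r : ℝ | ∃ φ₁ : V₁, ‖φ₁‖ = 1 ∧ r = a φ₁ v₂})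
    (hμ_pos : 0 < μ) (hμ : 1 / μ = discInfSup a U₁ U₂)
    {v r w : V₁} (hr : r ∈ U₁) (hvr : ∀ φ ∈ U₂, a (v - r) φ = 0) (hw : w ∈ U₁) :
    ‖v - r‖ ≤ μ * ‖v - w‖ := by
  let N : Submodule ℝ V₁ :=
    { carrier := {v | ∀ φ ∈ U₂, a v φ = 0}
      add_mem' := fun hx hy φ hφ => by simp [hx φ hφ, hy φ hφ]
      zero_mem' := fun φ _ => by simp
      smul_mem' := fun c x hx φ hφ => by simp [hx φ hφ] }
  have := norm_complement_le_of_norm_projection_le (U := U₁) (N := N)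
    (one_le_of_discInfSup hadj hμ_pos hμ)
    (fun u hu n hn => norm_galerkin_fst_le hadj hμ_pos hμ hu (fun φ hφ => by simpa using hn φ hφ))
    (U₁.sub_mem hr hw) (show v - r ∈ N from hvr)
  simpa using this

theorem norm_sub_galerkin_snd_le
    (hadj : ∀ v₂ : V₂, ‖v₂‖ = sSup {r : ℝ | ∃ φ₁ : V₁, ‖φ₁‖ = 1 ∧ r = a φ₁ v₂})
    (hμ_pos : 0 < μ) (hμ : 1 / μ = discInfSup a U₁ U₂)
    (hproj : ∀ v : V₁, ∃ r ∈ U₁, ∀ φ ∈ U₂, a (v - r) φ = 0)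
    {v r w : V₂} (hr : r ∈ U₂) (hvr : ∀ φ ∈ U₁, a φ (v - r) = 0) (hw : w ∈ U₂) :
    ‖v - r‖ ≤ μ * ‖v - w‖ := by
  let N : Submodule ℝ V₂ :=
    { carrier := {v | ∀ φ ∈ U₁, a φ v = 0}
      add_mem' := fun hx hy φ hφ => by simp [hx φ hφ, hy φ hφ]
      zero_mem' := fun φ _ => by simp
      smul_mem' := fun c x hx φ hφ => by simp [hx φ hφ] }
  have := norm_complement_le_of_norm_projection_le (U := U₂) (N := N)
    (one_le_of_discInfSup hadj hμ_pos hμ)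
    (fun u hu n hn => norm_snd_le_of_discInfSup hadj hμ_pos hμ hproj hu (norm_nonneg _)
      fun φ hφ => by
        have h := apply_le_of_adjointNorm hadj φ (u + n)
        rw [map_add, hn φ hφ, add_zero] at h
        linarith)
    (U₂.sub_mem hr hw) (show v - r ∈ N from hvr)
  simpa using this

theorem nV_sub_galerkin_le
    (hadj : ∀ v₂ : V₂, ‖v₂‖ = sSup {r : ℝ | ∃ φ₁ : V₁, ‖φ₁‖ = 1 ∧ r = a φ₁ v₂})
    (hμ_pos : 0 < μ) (hμ : 1 / μ = discInfSup a U₁ U₂)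
    (hproj : ∀ v : V₁, ∃ r ∈ U₁, ∀ φ ∈ U₂, a (v - r) φ = 0) {x r : V₁ × V₂}
    (hr1 : r.1 ∈ U₁) (hxr1 : ∀ φ ∈ U₂, a (x.1 - r.1) φ = 0)
    (hr2 : r.2 ∈ U₂) (hxr2 : ∀ φ ∈ U₁, a φ (x.2 - r.2) = 0) :
    nV (x - r) ≤ μ * bestErr U₁ U₂ x := by
  refine le_mul_bestErr hμ_pos fun v hv1 hv2 => ?_
  have h1 := norm_sub_galerkin_fst_le hadj hμ_pos hμ hr1 hxr1 hv1
  have h2 := norm_sub_galerkin_snd_le hadj hμ_pos hμ hproj hr2 hxr2 hv2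
  unfold nV
  rw [Real.sqrt_le_iff]
  refine ⟨by positivity, ?_⟩
  rw [mul_pow, Real.sq_sqrt (by positivity), mul_add, ← mul_pow, ← mul_pow]
  exact add_le_add (pow_le_pow_left₀ (norm_nonneg _) h1 2) (pow_le_pow_left₀ (norm_nonneg _) h2 2)

end Discrete

section DualityModulus

variable {V₁ V₂ Q W : Type*}
  [NormedAddCommGroup V₁] [InnerProductSpace ℝ V₁] [NormedAddCommGroup V₂] [InnerProductSpace ℝ V₂]
  [NormedAddCommGroup Q] [InnerProductSpace ℝ Q] [NormedAddCommGroup W] [InnerProductSpace ℝ W]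

/-- The vectors of norm at most one whose Galerkin projection onto `U₁ × U₂` vanishes. -/
def galerkinKernelBall (a : V₁ →L[ℝ] V₂ →L[ℝ] ℝ) (U₁ : Submodule ℝ V₁) (U₂ : Submodule ℝ V₂) :
    Set (V₁ × V₂) :=
  {v | nV v ≤ 1 ∧ (∀ φ ∈ U₂, a v.1 φ = 0) ∧ ∀ φ ∈ U₁, a φ v.2 = 0}

/-- The factor gained by measuring Galerkin errors in the seminorm `sV` instead of the norm. -/
noncomputable def dualityModulus (a : V₁ →L[ℝ] V₂ →L[ℝ] ℝ) (Cs : V₂ →L[ℝ] Q) (Iop : V₁ →L[ℝ] W)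
    (U₁ : Submodule ℝ V₁) (U₂ : Submodule ℝ V₂) : ℝ :=
  sSup (sV Cs Iop '' galerkinKernelBall a U₁ U₂)

variable {a : V₁ →L[ℝ] V₂ →L[ℝ] ℝ} {Cs : V₂ →L[ℝ] Q} {Iop : V₁ →L[ℝ] W}

theorem sV_nonneg (v : V₁ × V₂) : 0 ≤ sV Cs Iop v := Real.sqrt_nonneg _

theorem sV_smul (c : ℝ) (v : V₁ × V₂) : sV Cs Iop (c • v) = |c| * sV Cs Iop v := by
  have h : ∀ v : V₁ × V₂, sV Cs Iop v = nV (Iop v.1, Cs v.2) := fun _ => rfl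
  rw [h, h, ← nV_smul]
  simp

theorem sV_le_add (v : V₁ × V₂) : sV Cs Iop v ≤ ‖Iop v.1‖ + ‖Cs v.2‖ := by
  refine Real.sqrt_le_iff.2 ⟨by positivity, ?_⟩
  nlinarith [mul_nonneg (norm_nonneg (Iop v.1)) (norm_nonneg (Cs v.2))]

theorem dualityModulus_nonneg (U₁ : Submodule ℝ V₁) (U₂ : Submodule ℝ V₂) :
    0 ≤ dualityModulus a Cs Iop U₁ U₂ :=
  Real.sSup_nonneg (by rintro _ ⟨v, -, rfl⟩; exact sV_nonneg v)

theorem sV_le_dualityModulus_mul {U₁ : Submodule ℝ V₁} {U₂ : Submodule ℝ V₂} {v : V₁ × V₂}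
    (h1 : ∀ φ ∈ U₂, a v.1 φ = 0) (h2 : ∀ φ ∈ U₁, a φ v.2 = 0) :
    sV Cs Iop v ≤ dualityModulus a Cs Iop U₁ U₂ * nV v := by
  rcases (nV_nonneg_s19 v).eq_or_lt with h0 | hpos
  · have hv1 : v.1 = 0 := norm_le_zero_iff.1 (h0 ▸ norm_fst_le_nV v)
    have hv2 : v.2 = 0 := norm_le_zero_iff.1 (h0 ▸ norm_snd_le_nV v)
    simp [sV, hv1, hv2, ← h0]
  have hbdd : BddAbove (sV Cs Iop '' galerkinKernelBall a U₁ U₂) := by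
    refine ⟨‖Iop‖ + ‖Cs‖, ?_⟩
    rintro _ ⟨w, hw, rfl⟩
    refine (sV_le_add w).trans (add_le_add ?_ ?_)
    · exact Iop.unit_le_opNorm _ ((norm_fst_le_nV w).trans hw.1)
    · exact Cs.unit_le_opNorm _ ((norm_snd_le_nV w).trans hw.1)
  have hmem : (nV v)⁻¹ • v ∈ galerkinKernelBall a U₁ U₂ := by
    refine ⟨?_, fun φ hφ => by simp [h1 φ hφ], fun φ hφ => by simp [h2 φ hφ]⟩
    rw [nV_smul, abs_of_pos (by positivity), inv_mul_cancel₀ hpos.ne']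
  have := le_csSup hbdd ⟨_, hmem, rfl⟩
  rw [sV_smul, abs_of_pos (by positivity), inv_mul_le_iff₀ hpos] at this
  rw [mul_comm]
  exact this

theorem tendsto_dualityModulus [CompleteSpace V₁] [CompleteSpace V₂]
    [CompleteSpace Q] [CompleteSpace W]
    (hnd : ∀ v₁ : V₁, (∀ v₂ : V₂, a v₁ v₂ = 0) → v₁ = 0)
    (hadj : ∀ v₂ : V₂, ‖v₂‖ = sSup {r : ℝ | ∃ φ₁ : V₁, ‖φ₁‖ = 1 ∧ r = a φ₁ v₂})
    (hIc : IsCompactOperator Iop) (hCc : IsCompactOperator Cs)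
    {ι : Type*} {l : Filter ι} {U₁ : ι → Submodule ℝ V₁} {U₂ : ι → Submodule ℝ V₂}
    (happrox : ∀ v : V₁ × V₂, Tendsto (fun i => bestErr (U₁ i) (U₂ i) v) l (𝓝 0)) :
    Tendsto (fun i => dualityModulus a Cs Iop (U₁ i) (U₂ i)) l (𝓝 0) := by
  obtain ⟨B, hB⟩ := exists_linearIsometryEquiv_of_adjointNorm hnd hadj
  have hI : ∀ c > 0, ∀ᶠ i in l,
      ∀ v ∈ Prod.fst '' galerkinKernelBall a (U₁ i) (U₂ i), ‖Iop v‖ ≤ c := by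
    intro c hc
    refine hIc.eventually_norm_le ?_ (fun s c hc => ?_) hc
    · rintro i _ ⟨v, hv, rfl⟩
      exact (norm_fst_le_nV v).trans hv.1
    · filter_upwards [(happrox (0, B.symm (Iop.adjoint s))).eventually_le_const hc]
      rintro i hi _ ⟨v, hv, rfl⟩
      refine le_trans (le_bestErr fun w _ hw2 => ?_) hi
      have h1 : ⟪s, Iop v.1⟫ = a v.1 (B.symm (Iop.adjoint s) - w.2) := by
        rw [map_sub, hv.2.1 _ hw2, sub_zero, hB, B.apply_symm_apply,
          ContinuousLinearMap.adjoint_inner_left]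
      calc ⟪s, Iop v.1⟫ ≤ ‖v.1‖ * ‖B.symm (Iop.adjoint s) - w.2‖ :=
            h1 ▸ apply_le_of_adjointNorm hadj _ _
        _ ≤ 1 * nV ((0, B.symm (Iop.adjoint s)) - w) := by
            gcongr
            · exact (norm_fst_le_nV v).trans hv.1
            · exact norm_snd_le_nV ((0, B.symm (Iop.adjoint s)) - w)
        _ = _ := one_mul _
  have hC : ∀ c > 0, ∀ᶠ i in l,
      ∀ v ∈ Prod.snd '' galerkinKernelBall a (U₁ i) (U₂ i), ‖Cs v‖ ≤ c := by
    intro c hc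
    refine hCc.eventually_norm_le ?_ (fun s c hc => ?_) hc
    · rintro i _ ⟨v, hv, rfl⟩
      exact (norm_snd_le_nV v).trans hv.1
    · filter_upwards [(happrox (B (Cs.adjoint s), 0)).eventually_le_const hc]
      rintro i hi _ ⟨v, hv, rfl⟩
      refine le_trans (le_bestErr fun w hw1 _ => ?_) hi
      have h1 : ⟪s, Cs v.2⟫ = a (B (Cs.adjoint s) - w.1) v.2 := by
        rw [map_sub, sub_apply, hv.2.2 _ hw1, sub_zero, hB, B.inner_map_map, real_inner_comm,
          ContinuousLinearMap.adjoint_inner_right]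
      calc ⟪s, Cs v.2⟫ ≤ ‖B (Cs.adjoint s) - w.1‖ * ‖v.2‖ :=
            h1 ▸ apply_le_of_adjointNorm hadj _ _
        _ ≤ nV ((B (Cs.adjoint s), 0) - w) * 1 := by
            gcongr
            · exact nV_nonneg_s19 _
            · exact norm_fst_le_nV ((B (Cs.adjoint s), 0) - w)
            · exact (norm_snd_le_nV v).trans hv.1
        _ = _ := mul_one _
  refine Metric.tendsto_nhds.2 fun c hc => ?_
  filter_upwards [hI (c / 3) (by positivity), hC (c / 3) (by positivity)] with i hIi hCi
  rw [Real.dist_0_eq_abs, abs_of_nonneg (dualityModulus_nonneg _ _)]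
  refine (Real.sSup_le (a := 2 * (c / 3)) ?_ (by positivity)).trans_lt (by linarith)
  rintro _ ⟨v, hv, rfl⟩
  linarith [sV_le_add (Cs := Cs) (Iop := Iop) v, hIi _ ⟨v, hv, rfl⟩, hCi _ ⟨v, hv, rfl⟩]

end DualityModulus

section ControlConstraints

variable {V₁ V₂ Q W : Type*}
  [NormedAddCommGroup V₁] [InnerProductSpace ℝ V₁] [NormedAddCommGroup V₂] [InnerProductSpace ℝ V₂]
  [NormedAddCommGroup Q] [InnerProductSpace ℝ Q] [NormedAddCommGroup W] [InnerProductSpace ℝ W]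
  {a : V₁ →L[ℝ] V₂ →L[ℝ] ℝ} {Cs : V₂ →L[ℝ] Q} {Iop : V₁ →L[ℝ] W} {α : ℝ}

/-- The pseudometric `deltaK` between two states is controlled by the observed distance of the first
one to the point `r`, provided the discrete error equations hold for the test functions
built from `xh - r`. -/
theorem deltaK_le_sV {K : Set Q} (hK : Convex ℝ K) {PK : Q → Q} (hPK_mem : ∀ q, PK q ∈ K)
    (hPK : ∀ q, ∀ p ∈ K, ‖q - PK q‖ ≤ ‖q - p‖) (hα : 0 < α) {x xh r : V₁ × V₂}
    (h1 : a (xh.1 - r.1) (xh.2 - r.2) =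
      -⟪PK (-(Real.sqrt α)⁻¹ • Cs x.2) - PK (-(Real.sqrt α)⁻¹ • Cs xh.2), Cs (xh.2 - r.2)⟫)
    (h2 : a (xh.1 - r.1) (xh.2 - r.2) =
      -(Real.sqrt α)⁻¹ * ⟪Iop (x.1 - xh.1), Iop (xh.1 - r.1)⟫) :
    deltaK Cs Iop PK α x xh ≤ sV Cs Iop (x - r) := by
  have hs : 0 < Real.sqrt α := Real.sqrt_pos.2 hα
  have hs2 : Real.sqrt α ^ 2 = α := Real.sq_sqrt hα.le
  have hfirm := norm_sq_sub_le_inner_of_metric_projection hK hPK_mem hPK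
    (-(Real.sqrt α)⁻¹ • Cs x.2) (-(Real.sqrt α)⁻¹ • Cs xh.2)
  unfold deltaK sV
  set q := PK (-(Real.sqrt α)⁻¹ • Cs x.2) - PK (-(Real.sqrt α)⁻¹ • Cs xh.2) with hq
  set w := Iop (x.1 - xh.1) with hw
  set s := Real.sqrt α with hs_def
  rw [← smul_sub, ← map_sub, real_inner_smul_right] at hfirm
  have hz2 : Cs (xh.2 - r.2) = Cs (x.2 - r.2) - Cs (x.2 - xh.2) := by
    rw [← map_sub]; congr 1; abel
  have hz1 : Iop (xh.1 - r.1) = Iop (x.1 - r.1) - w := by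
    rw [hw, ← map_sub]; congr 1; abel
  rw [h1, hz2, hz1, inner_sub_right, inner_sub_right, real_inner_self_eq_norm_sq] at h2
  have hc1 := real_inner_le_norm w (Iop (x.1 - r.1))
  have hc2 := neg_le_of_abs_le (abs_real_inner_le_norm q (Cs (x.2 - r.2)))
  have hmain : α * ‖q‖ ^ 2 + ‖w‖ ^ 2 ≤
      s * ‖q‖ * ‖Cs (x.2 - r.2)‖ + ‖w‖ * ‖Iop (x.1 - r.1)‖ := by
    have e1 : s * (s⁻¹ * (⟪w, Iop (x.1 - r.1)⟫ - ‖w‖ ^ 2)) =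
        ⟪w, Iop (x.1 - r.1)⟫ - ‖w‖ ^ 2 := by field_simp
    have e2 : s * (⟪q, Cs (x.2 - r.2)⟫ - ⟪q, Cs (x.2 - xh.2)⟫) =
        ⟪w, Iop (x.1 - r.1)⟫ - ‖w‖ ^ 2 := by
      rw [← e1]; congr 1; linarith
    have e3 : s ^ 2 * ‖q‖ ^ 2 ≤ s ^ 2 * (-s⁻¹ * ⟪q, Cs (x.2 - xh.2)⟫) := by gcongr
    have e4 : s ^ 2 * (-s⁻¹ * ⟪q, Cs (x.2 - xh.2)⟫) = -s * ⟪q, Cs (x.2 - xh.2)⟫ := by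
      field_simp
    have e5 := mul_le_mul_of_nonneg_left hc2 hs.le
    rw [← hs2]
    linarith
  refine Real.sqrt_le_sqrt ?_
  have hsq : α * ‖q‖ ^ 2 = (s * ‖q‖) ^ 2 := by rw [mul_pow, hs2]
  rw [hsq] at hmain ⊢
  simp only [Prod.fst_sub, Prod.snd_sub]
  nlinarith [sq_nonneg (s * ‖q‖ - ‖Cs (x.2 - r.2)‖), sq_nonneg (‖w‖ - ‖Iop (x.1 - r.1)‖)]

/-- Quasi-best approximation with control constraints for a single discretization. -/
theorem nV_sub_le_of_bK_galerkin
    (hadj : ∀ v₂ : V₂, ‖v₂‖ = sSup {r : ℝ | ∃ φ₁ : V₁, ‖φ₁‖ = 1 ∧ r = a φ₁ v₂}) (hα : 0 < α)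
    {K : Set Q} (hK : Convex ℝ K) {PK : Q → Q} (hPK_mem : ∀ q, PK q ∈ K)
    (hPK : ∀ q, ∀ p ∈ K, ‖q - PK q‖ ≤ ‖q - p‖)
    {U₁ : Submodule ℝ V₁} {U₂ : Submodule ℝ V₂}
    [FiniteDimensional ℝ U₁] [FiniteDimensional ℝ U₂]
    (hnd1 : ∀ v₁ ∈ U₁, (∀ φ₂ ∈ U₂, a v₁ φ₂ = 0) → v₁ = 0)
    (hnd2 : ∀ v₂ ∈ U₂, (∀ φ₁ ∈ U₁, a φ₁ v₂ = 0) → v₂ = 0)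
    {μ : ℝ} (hμ_pos : 0 < μ) (hμ : 1 / μ = discInfSup a U₁ U₂) {x xh : V₁ × V₂}
    (hxh1 : xh.1 ∈ U₁) (hxh2 : xh.2 ∈ U₂)
    (horth : ∀ φ : V₁ × V₂, φ.1 ∈ U₁ → φ.2 ∈ U₂ →
      bK a Cs Iop PK α x φ = bK a Cs Iop PK α xh φ) :
    nV (x - xh) ≤ μ * (1 + max ‖Iop‖ ‖Cs‖ / Real.sqrt α *
      (μ * dualityModulus a Cs Iop U₁ U₂)) * bestErr U₁ U₂ x := by
  obtain ⟨hproj1, hproj2⟩ := exists_galerkin_projection hnd1 hnd2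
  obtain ⟨r₁, hr1, hxr1⟩ := hproj1 x.1
  obtain ⟨r₂, hr2, hxr2⟩ := hproj2 x.2
  have hs : 0 < Real.sqrt α := Real.sqrt_pos.2 hα
  have hs2 : Real.sqrt α ^ 2 = α := Real.sq_sqrt hα.le
  set m := max ‖Iop‖ ‖Cs‖ with hm
  have hm0 : 0 ≤ m := (norm_nonneg _).trans (le_max_left _ _)
  set q := PK (-(Real.sqrt α)⁻¹ • Cs x.2) - PK (-(Real.sqrt α)⁻¹ • Cs xh.2) with hq
  set w := Iop (x.1 - xh.1) with hw
  have hz1 : ∀ φ ∈ U₂, a (xh.1 - r₁) φ = -⟪q, Cs φ⟫ := by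
    intro φ hφ
    have h := horth (0, φ) U₁.zero_mem hφ
    have h' := hxr1 φ hφ
    simp only [bK, aV, cK, map_zero, zero_apply, inner_zero_right, mul_zero, sub_zero,
      add_zero] at h
    rw [map_sub, sub_apply] at h'
    rw [map_sub, sub_apply, hq, inner_sub_left]
    linarith
  have hz2 : ∀ φ ∈ U₁, a φ (xh.2 - r₂) = -(Real.sqrt α)⁻¹ * ⟪w, Iop φ⟫ := by
    intro φ hφ
    have h := horth (φ, 0) hφ U₂.zero_mem
    have h' := hxr2 φ hφ
    simp only [bK, aV, cK, map_zero, inner_zero_right, neg_zero, zero_sub, zero_add] at h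
    rw [map_sub] at h'
    rw [map_sub, hw, map_sub, inner_sub_left]
    linarith
  have hδ : deltaK Cs Iop PK α x xh ≤ sV Cs Iop (x - (r₁, r₂)) :=
    deltaK_le_sV hK hPK_mem hPK hα (hz1 _ (U₂.sub_mem hxh2 hr2))
      (hz2 _ (U₁.sub_mem hxh1 hr1))
  have hδ0 : 0 ≤ deltaK Cs Iop PK α x xh := Real.sqrt_nonneg _
  have hδsq : deltaK Cs Iop PK α x xh ^ 2 = α * ‖q‖ ^ 2 + ‖w‖ ^ 2 :=
    Real.sq_sqrt (by positivity)
  have hb1 : ‖xh.1 - r₁‖ ≤ μ * (m * ‖q‖) := by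
    refine norm_le_of_discInfSup hμ_pos hμ (U₁.sub_mem hxh1 hr1) (by positivity) fun φ hφ => ?_
    rw [hz1 φ hφ]
    calc -⟪q, Cs φ⟫ ≤ ‖q‖ * ‖Cs φ‖ := (neg_le_abs _).trans (abs_real_inner_le_norm _ _)
      _ ≤ ‖q‖ * (m * ‖φ‖) := by
          gcongr
          exact Cs.le_of_opNorm_le (le_max_right _ _) φ
      _ = m * ‖q‖ * ‖φ‖ := by ring
  have hb2 : ‖xh.2 - r₂‖ ≤ μ * (m * ((Real.sqrt α)⁻¹ * ‖w‖)) := by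
    refine norm_snd_le_of_discInfSup hadj hμ_pos hμ hproj1 (U₂.sub_mem hxh2 hr2) (by positivity)
      fun φ hφ => ?_
    rw [hz2 φ hφ]
    calc -(Real.sqrt α)⁻¹ * ⟪w, Iop φ⟫ = (Real.sqrt α)⁻¹ * -⟪w, Iop φ⟫ := by ring
      _ ≤ (Real.sqrt α)⁻¹ * (‖w‖ * ‖Iop φ‖) := by
          gcongr
          exact (neg_le_abs _).trans (abs_real_inner_le_norm _ _)
      _ ≤ (Real.sqrt α)⁻¹ * (‖w‖ * (m * ‖φ‖)) := by
          gcongr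
          exact Iop.le_of_opNorm_le (le_max_left _ _) φ
      _ = m * ((Real.sqrt α)⁻¹ * ‖w‖) * ‖φ‖ := by ring
  have hz : nV (xh - (r₁, r₂)) ≤ μ * (m / Real.sqrt α) * deltaK Cs Iop PK α x xh := by
    refine Real.sqrt_le_iff.2 ⟨by positivity, ?_⟩
    calc ‖xh.1 - r₁‖ ^ 2 + ‖xh.2 - r₂‖ ^ 2
        ≤ (μ * (m * ‖q‖)) ^ 2 + (μ * (m * ((Real.sqrt α)⁻¹ * ‖w‖))) ^ 2 := by gcongr
      _ = (μ * (m / Real.sqrt α)) ^ 2 * (Real.sqrt α ^ 2 * ‖q‖ ^ 2 + ‖w‖ ^ 2) := by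
          field_simp
      _ = (μ * (m / Real.sqrt α) * deltaK Cs Iop PK α x xh) ^ 2 := by
          rw [hs2, mul_pow _ (deltaK Cs Iop PK α x xh), hδsq]
  have hρ : nV (x - (r₁, r₂)) ≤ μ * bestErr U₁ U₂ x :=
    nV_sub_galerkin_le hadj hμ_pos hμ hproj1 hr1 hxr1 hr2 hxr2
  have hdual : sV Cs Iop (x - (r₁, r₂)) ≤
      dualityModulus a Cs Iop U₁ U₂ * nV (x - (r₁, r₂)) :=
    sV_le_dualityModulus_mul hxr1 hxr2
  have hd0 := dualityModulus_nonneg (a := a) (Cs := Cs) (Iop := Iop) U₁ U₂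
  calc nV (x - xh) = nV (x - (r₁, r₂) - (xh - (r₁, r₂))) := by rw [sub_sub_sub_cancel_right]
    _ ≤ nV (x - (r₁, r₂)) + nV (xh - (r₁, r₂)) := nV_sub_le _ _
    _ ≤ nV (x - (r₁, r₂)) + μ * (m / Real.sqrt α) *
        (dualityModulus a Cs Iop U₁ U₂ * nV (x - (r₁, r₂))) := by
        gcongr
        exact hz.trans (by gcongr; exact hδ.trans hdual)
    _ = (1 + m / Real.sqrt α * (μ * dualityModulus a Cs Iop U₁ U₂)) * nV (x - (r₁, r₂)) := by
        ring
    _ ≤ (1 + m / Real.sqrt α * (μ * dualityModulus a Cs Iop U₁ U₂)) *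
        (μ * bestErr U₁ U₂ x) := by gcongr
    _ = _ := by ring

end ControlConstraints

/-- Corollary 5.7, asymptotic quasi-best approximation with control
constraints: there is `ε(h) → 0`, independent of the desired state, with
`‖x − x_h‖ ≤ μ_h (1 + (M/√α) κ̄ ε(h)) inf_{v_h ∈ V_h} ‖x − v_h‖`. -/
theorem stmt19
    {V₁ V₂ Q W : Type*}
    [NormedAddCommGroup V₁] [InnerProductSpace ℝ V₁] [CompleteSpace V₁] [Nontrivial V₁]
    [NormedAddCommGroup V₂] [InnerProductSpace ℝ V₂] [CompleteSpace V₂] [Nontrivial V₂]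
    [NormedAddCommGroup Q] [InnerProductSpace ℝ Q] [CompleteSpace Q]
    [NormedAddCommGroup W] [InnerProductSpace ℝ W] [CompleteSpace W]
    (a : V₁ →L[ℝ] V₂ →L[ℝ] ℝ) (Cs : V₂ →L[ℝ] Q) (Iop : V₁ →L[ℝ] W)
    (α m_a M_C M_I M L : ℝ) (hα : 0 < α)
    (hma : m_a = infSupConst a) (hma_pos : 0 < m_a)
    (hnd : ∀ v₁ : V₁, (∀ v₂ : V₂, a v₁ v₂ = 0) → v₁ = 0)
    (hadj : ∀ v₂ : V₂, ‖v₂‖ = sSup {r : ℝ | ∃ φ₁ : V₁, ‖φ₁‖ = 1 ∧ r = a φ₁ v₂})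
    (hMC : M_C = ‖Cs‖) (hMI : M_I = ‖Iop‖) (hM : M = max M_I M_C)
    (hL : L = M / Real.sqrt α)
    -- compactness of the observation and control-action operators
    (hIc : IsCompactOperator (⇑Iop)) (hCc : IsCompactOperator (⇑Cs))
    (K : Set Q) (hK_ne : K.Nonempty) (hK_cl : IsClosed K) (hK_cx : Convex ℝ K)
    (PK : Q → Q) (hPK_mem : ∀ q, PK q ∈ K)
    (hPK : ∀ q : Q, ∀ p ∈ K, ‖q - PK q‖ ≤ ‖q - p‖)
    -- family of discretizations
    (Vh1 : ℝ → Submodule ℝ V₁) (Vh2 : ℝ → Submodule ℝ V₂)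
    (hfd1 : ∀ h > (0 : ℝ), FiniteDimensional ℝ (Vh1 h))
    (hfd2 : ∀ h > (0 : ℝ), FiniteDimensional ℝ (Vh2 h))
    (hndh1 : ∀ h > (0 : ℝ), ∀ v₁ ∈ Vh1 h, (∀ φ₂ ∈ Vh2 h, a v₁ φ₂ = 0) → v₁ = 0)
    (hndh2 : ∀ h > (0 : ℝ), ∀ v₂ ∈ Vh2 h, (∀ φ₁ ∈ Vh1 h, a φ₁ v₂ = 0) → v₂ = 0)
    (μ : ℝ → ℝ) (μbar κbar : ℝ)
    (hμ_pos : ∀ h > (0 : ℝ), 0 < μ h)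
    (hμ : ∀ h > (0 : ℝ), 1 / μ h = discInfSup a (Vh1 h) (Vh2 h))
    (hstab : ∀ h > (0 : ℝ), μ h ≤ μbar)
    (hκbar : κbar = ((1 + 2 * L) / (1 + L)) * (1 + M * (1 + 2 * M / Real.sqrt α) * μbar))
    (happrox : ∀ v : V₁ × V₂,
      Tendsto (fun h => bestErr (Vh1 h) (Vh2 h) v) (𝓝[>] (0 : ℝ)) (𝓝 0)) :
    ∃ ε : ℝ → ℝ, (∀ h, 0 ≤ ε h) ∧ Tendsto ε (𝓝[>] (0 : ℝ)) (𝓝 0) ∧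
      ∀ u_d : W, ∀ x : V₁ × V₂,
        (∀ φ : V₁ × V₂, bK a Cs Iop PK α x φ = -(Real.sqrt α)⁻¹ * ⟪u_d, Iop φ.1⟫) →
        ∀ xh : ℝ → V₁ × V₂,
          (∀ h > (0 : ℝ), ((xh h).1 ∈ Vh1 h ∧ (xh h).2 ∈ Vh2 h) ∧
            ∀ φh : V₁ × V₂, φh.1 ∈ Vh1 h → φh.2 ∈ Vh2 h →
              bK a Cs Iop PK α (xh h) φh = -(Real.sqrt α)⁻¹ * ⟪u_d, Iop φh.1⟫) →
          ∀ h > (0 : ℝ), nV (x - xh h) ≤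
            μ h * (1 + (M / Real.sqrt α) * κbar * ε h) * bestErr (Vh1 h) (Vh2 h) x := by
  subst hMC hMI hM hL
  have hM0 : 0 ≤ max ‖Iop‖ ‖Cs‖ := (norm_nonneg _).trans (le_max_left _ _)
  have hs : 0 < Real.sqrt α := Real.sqrt_pos.2 hα
  have hμbar : 0 < μbar := (hμ_pos 1 one_pos).trans_le (hstab 1 one_pos)
  have hκ : 0 < κbar := by rw [hκbar]; positivity
  refine ⟨fun h => μbar / κbar * dualityModulus a Cs Iop (Vh1 h) (Vh2 h), fun h =>
    mul_nonneg (by positivity) (dualityModulus_nonneg _ _), ?_, ?_⟩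
  · simpa using (tendsto_dualityModulus hnd hadj hIc hCc happrox).const_mul (μbar / κbar)
  intro u_d x hx xh hxh h hh
  have := hfd1 h hh
  have := hfd2 h hh
  have hμh := hμ_pos h hh
  have hd0 := dualityModulus_nonneg (a := a) (Cs := Cs) (Iop := Iop) (Vh1 h) (Vh2 h)
  have hb0 := bestErr_nonneg (Vh1 h) (Vh2 h) x
  obtain ⟨⟨hxh1, hxh2⟩, hsol⟩ := hxh h hh
  refine (nV_sub_le_of_bK_galerkin hadj hα hK_cx hPK_mem hPK (hndh1 h hh) (hndh2 h hh)
    hμh (hμ h hh) hxh1 hxh2 fun φ h1 h2 => (hx φ).trans (hsol φ h1 h2).symm).trans ?_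
  rw [show max ‖Iop‖ ‖Cs‖ / Real.sqrt α * κbar *
      (μbar / κbar * dualityModulus a Cs Iop (Vh1 h) (Vh2 h)) =
      max ‖Iop‖ ‖Cs‖ / Real.sqrt α * (μbar * dualityModulus a Cs Iop (Vh1 h) (Vh2 h)) by
    field_simp]
  gcongr
  exact hstab h hh
end
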